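/- Let X be a nonempty finite metric space, and for t > 0 let Z_t be the similarity matrix with entries exp(−t · dist x x'). Then there exists T > 0 such that Z_t is invertible for all t ≥ T and the magnitude function t ↦ ∑_{x,x'} (Z_t)⁻¹(x, x') is monotone increasing on the interval [T, ∞). -/

import Mathlib

open Filter Matrix

/-- The similarity matrix of a finite metric space at scale `t`. -/
noncomputable def simMatrix (X : Type*) [Fintype X] [MetricSpace X] (t : ℝ) :
    Matrix X X ℝ :=
  Matrix.of fun x x' : X => Real.exp (-t * dist x x')

theorem tendsto_simMatrix_atTop (X : Type*) [Fintype X] [DecidableEq X] [MetricSpace X] :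
    Tendsto (simMatrix X) atTop (nhds 1) := by
  refine tendsto_pi_nhds.2 fun x => tendsto_pi_nhds.2 fun y => ?_
  rcases eq_or_ne x y with rfl | hxy
  · simp [simMatrix]
  · simp only [simMatrix, of_apply, one_apply_ne hxy]
    exact Real.tendsto_exp_atBot.comp
      (tendsto_neg_atTop_atBot.atBot_mul_const (dist_pos.2 hxy))

theorem simMatrix_isSymm (X : Type*) [Fintype X] [MetricSpace X] (t : ℝ) :
    (simMatrix X t).IsSymm := by
  ext x y
  simp [simMatrix, dist_comm]

theorem tendsto_det_simMatrix_atTop (X : Type*) [Fintype X] [DecidableEq X] [MetricSpace X] :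
    Tendsto (fun t => (simMatrix X t).det) atTop (nhds 1) := by
  simpa [Function.comp_def] using
    ((continuous_id.matrix_det (A := id)).tendsto (1 : Matrix X X ℝ)).comp
      (tendsto_simMatrix_atTop X)

theorem eventually_isUnit_simMatrix (X : Type*) [Fintype X] [DecidableEq X] [MetricSpace X] :
    ∀ᶠ t in atTop, IsUnit (simMatrix X t) := by
  filter_upwards [(tendsto_det_simMatrix_atTop X).eventually_ne one_ne_zero] with t ht
  exact (isUnit_iff_isUnit_det _).2 ht.isUnit

theorem tendsto_inv_simMatrix_atTop (X : Type*) [Fintype X] [DecidableEq X] [MetricSpace X] :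
    Tendsto (fun t => (simMatrix X t)⁻¹) atTop (nhds 1) := by
  have hadj : Tendsto (fun t => (simMatrix X t).adjugate) atTop (nhds 1) := by
    simpa [Function.comp_def] using
      ((continuous_id.matrix_adjugate (A := id)).tendsto (1 : Matrix X X ℝ)).comp
        (tendsto_simMatrix_atTop X)
  simpa [inv_def, Ring.inverse_eq_inv'] using
    ((tendsto_det_simMatrix_atTop X).inv₀ one_ne_zero).smul hadj

/-- At large scales the weighting `Z⁻¹ 1` is nonnegative, since it tends to the constant `1`. -/
theorem eventually_weighting_nonneg (X : Type*) [Fintype X] [DecidableEq X] [MetricSpace X] :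
    ∀ᶠ t in atTop, 0 ≤ (simMatrix X t)⁻¹ *ᵥ 1 := by
  have h : Tendsto (fun t => (simMatrix X t)⁻¹ *ᵥ (1 : X → ℝ)) atTop (nhds 1) := by
    simpa [Function.comp_def] using
      ((continuous_id.matrix_mulVec (A := id) continuous_const).tendsto
        (1 : Matrix X X ℝ)).comp (tendsto_inv_simMatrix_atTop X)
  filter_upwards [eventually_all.2 fun x =>
    (tendsto_pi_nhds.1 h x).eventually_const_le one_pos] with t ht
  exact ht

theorem sum_sum_inv_sub_sum_sum_inv {n R : Type*} [Fintype n] [DecidableEq n] [CommRing R]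
    {A B : Matrix n n R} (hA : IsUnit A) (hB : IsUnit B) (hsymm : B.IsSymm) :
    ∑ x, ∑ y, B⁻¹ x y - ∑ x, ∑ y, A⁻¹ x y =
      (B⁻¹ *ᵥ 1) ⬝ᵥ ((A - B) *ᵥ (A⁻¹ *ᵥ 1)) := by
  have hA' := (isUnit_iff_isUnit_det _).1 hA
  have hB' := (isUnit_iff_isUnit_det _).1 hB
  have hBw : (B⁻¹ *ᵥ 1) ᵥ* B = 1 := by
    rw [← mulVec_transpose, hsymm.eq, mulVec_mulVec, mul_nonsing_inv _ hB', one_mulVec]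
  rw [sub_mulVec, dotProduct_sub, dotProduct_mulVec _ B, hBw, mulVec_mulVec,
    mul_nonsing_inv _ hA', one_mulVec]
  simp [dotProduct, mulVec]

/-- For `t` large the similarity matrix is invertible and the magnitude function
is monotone increasing on `[T, ∞)`. -/
theorem magnitude_eventually_monotone (X : Type*) [Fintype X] [DecidableEq X] [Nonempty X]
    [MetricSpace X] :
    ∃ T : ℝ, 0 < T ∧ (∀ t : ℝ, T ≤ t → IsUnit (simMatrix X t)) ∧
      MonotoneOn (fun t : ℝ => ∑ x : X, ∑ x' : X, (simMatrix X t)⁻¹ x x')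
        (Set.Ici T) := by
  obtain ⟨T, hT⟩ := eventually_atTop.1
    ((eventually_isUnit_simMatrix X).and (eventually_weighting_nonneg X))
  have hle : ∀ t, max T 1 ≤ t → T ≤ t := fun t ht => (le_max_left T 1).trans ht
  refine ⟨max T 1, by positivity, fun t ht => (hT t (hle t ht)).1, fun s hs t ht hst => ?_⟩
  obtain ⟨hsu, hsw⟩ := hT s (hle s hs)
  obtain ⟨htu, htw⟩ := hT t (hle t ht)
  rw [← sub_nonneg, sum_sum_inv_sub_sum_sum_inv hsu htu (simMatrix_isSymm X t)]
  refine dotProduct_nonneg_of_nonneg htw fun x => dotProduct_nonneg_of_nonneg (fun y => ?_) hsw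
  simp only [simMatrix, Matrix.sub_apply, of_apply, Pi.zero_apply, sub_nonneg]
  gcongr
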